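/- For any positive reals a₁,…,a_n and any polynomials F, G ∈ ℂ[Z,Z'] in the variables Z, Z' ∈ ℝ^{2n}, there exists a polynomial 𝒦[F,G] ∈ ℂ[Z,Z'] such that the composition of the integral kernels F𝒫 and G𝒫 on ℝ^{2n} satisfies ∫_{ℝ^{2n}} F(Z,Z'')𝒫(Z,Z'') G(Z'',Z')𝒫(Z'',Z') dZ'' = 𝒦[F,G](Z,Z') 𝒫(Z,Z'). -/

import Mathlib

noncomputable section

/-- The model space `ℝ^{2n}`. -/
abbrev V (n : ℕ) : Type := EuclideanSpace ℝ (Fin (2 * n))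

/-- The complex coordinates `z_j = Z_{2j−1} + √−1 Z_{2j}` of `Z ∈ ℝ^{2n} ≃ ℂ^n`. -/
def zc {n : ℕ} (Z : V n) (j : Fin n) : ℂ :=
  (Z ⟨2 * j.1, by have := j.2; omega⟩ : ℝ) +
    Complex.I * (Z ⟨2 * j.1 + 1, by have := j.2; omega⟩ : ℝ)

/-- The Gaussian kernel
`𝒫(Z,Z') = exp(−¼ Σ_j a_j (|z_j|² + |z'_j|² − 2 z_j z̄'_j))`. -/
def gaussP {n : ℕ} (a : Fin n → ℝ) (Z Z' : V n) : ℂ :=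
  Complex.exp (-(1 / 4 : ℂ) * ∑ j : Fin n, (a j : ℂ) *
    ((Complex.normSq (zc Z j) : ℂ) + (Complex.normSq (zc Z' j) : ℂ)
      - 2 * zc Z j * (starRingEnd ℂ) (zc Z' j)))

open MeasureTheory

theorem integrable_pow_mul_cexp_neg_mul_sub_sq {b : ℝ} (hb : 0 < b) (c : ℂ) (m : ℕ) :
    Integrable fun x : ℝ => (x : ℂ) ^ m * Complex.exp (-(b : ℂ) * ((x : ℂ) - c) ^ 2) := by
  have key (s : ℂ) : Integrable fun x : ℝ =>
      Complex.exp (-(b : ℂ) * (x : ℂ) ^ 2 + (2 * b * c + s) * x + -(b : ℂ) * c ^ 2) :=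
    integrable_cexp_quadratic' (by simpa using hb) _ _
  refine (((key 1).norm.add (key (-1)).norm).const_mul (m.factorial : ℝ)).mono'
    (by fun_prop) (.of_forall fun x => ?_)
  have hexp (s : ℂ) : Complex.exp (-(b : ℂ) * (x : ℂ) ^ 2 + (2 * b * c + s) * x + -(b : ℂ) * c ^ 2)
      = Complex.exp (s * x) * Complex.exp (-(b : ℂ) * ((x : ℂ) - c) ^ 2) := by
    rw [← Complex.exp_add]; congr 1; ring
  simp only [Pi.add_apply, hexp, norm_mul, norm_pow, Complex.norm_exp (_ * (x : ℂ))]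
  rw [← add_mul, ← mul_assoc]
  gcongr
  have h := Real.pow_div_factorial_le_exp |x| (abs_nonneg x) m
  rw [div_le_iff₀ (by positivity)] at h
  have h2 : Real.exp |x| ≤ Real.exp x + Real.exp (-x) := by
    rcases abs_cases x with ⟨h, -⟩ | ⟨h, -⟩ <;> rw [h] <;>
      linarith [Real.exp_pos x, Real.exp_pos (-x)]
  simp only [Complex.norm_real, Real.norm_eq_abs, one_mul, Complex.ofReal_re, neg_mul,
    Complex.neg_re]
  nlinarith [(Nat.cast_pos (α := ℝ)).2 m.factorial_pos]

theorem integral_pow_succ_mul_cexp_neg_mul_sub_sq {b : ℝ} (hb : 0 < b) (c : ℂ) (m : ℕ) :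
    ∫ x : ℝ, (x : ℂ) ^ (m + 1) * Complex.exp (-(b : ℂ) * ((x : ℂ) - c) ^ 2) =
      c * (∫ x : ℝ, (x : ℂ) ^ m * Complex.exp (-(b : ℂ) * ((x : ℂ) - c) ^ 2)) +
      m / (2 * b) *
        ∫ x : ℝ, (x : ℂ) ^ (m - 1) * Complex.exp (-(b : ℂ) * ((x : ℂ) - c) ^ 2) := by
  have hI := integrable_pow_mul_cexp_neg_mul_sub_sq hb c
  have hb' : (b : ℂ) ≠ 0 := by exact_mod_cast hb.ne'
  have hd (x : ℝ) : HasDerivAt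
      (fun x : ℝ => (x : ℂ) ^ m * Complex.exp (-(b : ℂ) * ((x : ℂ) - c) ^ 2))
      (m * ((x : ℂ) ^ (m - 1) * Complex.exp (-(b : ℂ) * ((x : ℂ) - c) ^ 2)) +
        (2 * b * c * ((x : ℂ) ^ m * Complex.exp (-(b : ℂ) * ((x : ℂ) - c) ^ 2)) -
        2 * b * ((x : ℂ) ^ (m + 1) * Complex.exp (-(b : ℂ) * ((x : ℂ) - c) ^ 2)))) x := by
    have h1 : HasDerivAt (fun z : ℂ => z ^ m * Complex.exp (-(b : ℂ) * (z - c) ^ 2)) _ (x : ℂ) :=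
      (hasDerivAt_pow m (x : ℂ)).mul
        ((((hasDerivAt_id (x : ℂ)).sub_const c).pow 2).const_mul (-(b : ℂ))).cexp
    convert h1.comp_ofReal using 1
    simp
    ring
  have hsub : Integrable fun x : ℝ =>
      2 * b * c * ((x : ℂ) ^ m * Complex.exp (-(b : ℂ) * ((x : ℂ) - c) ^ 2)) -
        2 * b * ((x : ℂ) ^ (m + 1) * Complex.exp (-(b : ℂ) * ((x : ℂ) - c) ^ 2)) :=
    ((hI m).const_mul _).sub ((hI (m + 1)).const_mul _)
  have h0 := integral_eq_zero_of_hasDerivAt_of_integrable hd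
    (((hI (m - 1)).const_mul _).add hsub) (hI m)
  rw [integral_add ((hI (m - 1)).const_mul _) hsub,
    integral_sub ((hI m).const_mul _) ((hI (m + 1)).const_mul _)] at h0
  simp only [integral_const_mul] at h0
  have hm : 2 * (b : ℂ) * (m / (2 * b)) = m := by field_simp
  refine mul_left_cancel₀ (mul_ne_zero two_ne_zero hb') ?_
  linear_combination -h0 -
    (∫ x : ℝ, (x : ℂ) ^ (m - 1) * Complex.exp (-(b : ℂ) * ((x : ℂ) - c) ^ 2)) * hm

theorem exists_polynomial_integral_pow_mul_cexp {b : ℝ} (hb : 0 < b) (m : ℕ) :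
    ∃ q : Polynomial ℂ, ∀ c : ℂ,
      ∫ x : ℝ, (x : ℂ) ^ m * Complex.exp (-(b : ℂ) * ((x : ℂ) - c) ^ 2) = q.eval c := by
  induction m using Nat.strong_induction_on with
  | _ m ih =>
    rcases m with _ | m
    · refine ⟨.C ((Real.pi / b : ℂ) ^ (1 / 2 : ℂ)), fun c => ?_⟩
      have h := integral_cexp_quadratic (b := -(b : ℂ)) (by simpa using hb)
        (2 * b * c) (-(b : ℂ) * c ^ 2)
      have hb' : (b : ℂ) ≠ 0 := by exact_mod_cast hb.ne'
      have he : -(b : ℂ) * c ^ 2 - (2 * b * c) ^ 2 / (4 * -(b : ℂ)) = 0 := by field_simp; ring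
      rw [he, Complex.exp_zero, mul_one, neg_neg] at h
      rw [Polynomial.eval_C, ← h]
      congr 1 with x
      rw [pow_zero, one_mul]
      congr 1
      ring
    · obtain ⟨q, hq⟩ := ih m (by omega)
      obtain ⟨r, hr⟩ := ih (m - 1) (by omega)
      refine ⟨.X * q + .C (m / (2 * b)) * r, fun c => ?_⟩
      rw [integral_pow_succ_mul_cexp_neg_mul_sub_sq hb, hq, hr]
      simp

theorem exists_integral_eval₂_mul_prod_cexp {ι R : Type*} [Fintype ι] [CommRing R] [Algebra ℂ R]
    {b : ι → ℝ} (hb : ∀ i, 0 < b i) (c : ι → R) (H : MvPolynomial ι R) :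
    ∃ K : R, ∀ φ : R →ₐ[ℂ] ℂ,
      Integrable (fun w : ι → ℝ => MvPolynomial.eval₂ (φ : R →+* ℂ) (fun i => (w i : ℂ)) H *
        ∏ i, Complex.exp (-(b i : ℂ) * ((w i : ℂ) - φ (c i)) ^ 2)) ∧
      ∫ w : ι → ℝ, MvPolynomial.eval₂ (φ : R →+* ℂ) (fun i => (w i : ℂ)) H *
        ∏ i, Complex.exp (-(b i : ℂ) * ((w i : ℂ) - φ (c i)) ^ 2) = φ K := by
  induction H using MvPolynomial.induction_on' with
  | monomial u r =>
    choose q hq using fun i => exists_polynomial_integral_pow_mul_cexp (hb i) (u i)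
    refine ⟨r * ∏ i, Polynomial.aeval (c i) (q i), fun φ => ?_⟩
    have he (w : ι → ℝ) :
        MvPolynomial.eval₂ (φ : R →+* ℂ) (fun i => (w i : ℂ)) (.monomial u r) *
          ∏ i, Complex.exp (-(b i : ℂ) * ((w i : ℂ) - φ (c i)) ^ 2) =
        φ r * ∏ i, ((w i : ℂ) ^ u i * Complex.exp (-(b i : ℂ) * ((w i : ℂ) - φ (c i)) ^ 2)) := by
      rw [MvPolynomial.eval₂_monomial, Finsupp.prod_fintype _ _ (by simp),
        Finset.prod_mul_distrib, mul_assoc]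
      rfl
    simp only [he]
    constructor
    · exact (Integrable.fintype_prod fun i =>
        integrable_pow_mul_cexp_neg_mul_sub_sq (hb i) (φ (c i)) (u i)).const_mul _
    · rw [integral_const_mul, integral_fintype_prod_volume_eq_prod
        fun i (x : ℝ) => (x : ℂ) ^ u i * Complex.exp (-(b i : ℂ) * ((x : ℂ) - φ (c i)) ^ 2)]
      simp only [hq, map_mul, map_prod, ← Polynomial.aeval_algHom_apply,
        Polynomial.coe_aeval_eq_eval]
  | add p q hp hq =>
    obtain ⟨K, hK⟩ := hp
    obtain ⟨L, hL⟩ := hq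
    refine ⟨K + L, fun φ => ?_⟩
    simp only [MvPolynomial.eval₂_add, add_mul]
    exact ⟨(hK φ).1.add (hL φ).1, by
      rw [integral_add (hK φ).1 (hL φ).1, (hK φ).2, (hL φ).2, map_add]⟩

theorem Fin.sum_univ_two_mul {M : Type*} [AddCommMonoid M] (n : ℕ) (f : Fin (2 * n) → M) :
    ∑ i, f i = ∑ j : Fin n, (f ⟨2 * j.1, by omega⟩ + f ⟨2 * j.1 + 1, by omega⟩) := by
  induction n with
  | zero => rfl
  | succ n ih =>
    rw [Fin.sum_univ_castSucc (n := n), ← add_assoc]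
    refine (Fin.sum_univ_castSucc (n := 2 * n + 1) f).trans ?_
    rw [Fin.sum_univ_castSucc, ih]
    rfl

/-- The holomorphic coordinate `z_j` of the first variable, as a polynomial. -/
def holoCoord {n : ℕ} (j : Fin n) : MvPolynomial (Fin (2 * n) ⊕ Fin (2 * n)) ℂ :=
  .X (.inl ⟨2 * j.1, by omega⟩) + .C Complex.I * .X (.inl ⟨2 * j.1 + 1, by omega⟩)

/-- The antiholomorphic coordinate `z̄'_j` of the second variable, as a polynomial. -/
def antiholoCoord {n : ℕ} (j : Fin n) : MvPolynomial (Fin (2 * n) ⊕ Fin (2 * n)) ℂ :=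
  .X (.inr ⟨2 * j.1, by omega⟩) - .C Complex.I * .X (.inr ⟨2 * j.1 + 1, by omega⟩)

/-- The complex centre of the Gaussian `Z'' ↦ 𝒫(Z,Z'') 𝒫(Z'',Z')`, as a polynomial
in `Z` and `Z'`. -/
def gaussCentre {n : ℕ} (i : Fin (2 * n)) : MvPolynomial (Fin (2 * n) ⊕ Fin (2 * n)) ℂ :=
  if i.1 % 2 = 0 then
    .C (1 / 2) * (holoCoord ⟨i.1 / 2, by omega⟩ + antiholoCoord ⟨i.1 / 2, by omega⟩)
  else
    .C (Complex.I / 2) * (antiholoCoord ⟨i.1 / 2, by omega⟩ - holoCoord ⟨i.1 / 2, by omega⟩)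

theorem gaussP_mul_gaussP {n : ℕ} (a : Fin n → ℝ) (Z W Z' : V n) :
    gaussP a Z W * gaussP a W Z' = gaussP a Z Z' *
      ∏ i : Fin (2 * n), Complex.exp (-((a ⟨i.1 / 2, by omega⟩ / 2 : ℝ) : ℂ) * ((W i : ℂ) -
        MvPolynomial.aeval (Sum.elim (fun j => (Z j : ℂ)) (fun j => (Z' j : ℂ)))
          (gaussCentre i)) ^ 2) := by
  unfold gaussP
  rw [← Complex.exp_sum, ← Complex.exp_add, ← Complex.exp_add, Fin.sum_univ_two_mul,
    Finset.mul_sum, Finset.mul_sum, Finset.mul_sum, ← Finset.sum_add_distrib,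
    ← Finset.sum_add_distrib]
  congr 1
  refine Finset.sum_congr rfl fun j _ => ?_
  have h1 : (2 * j.1 + 1) / 2 = j.1 := by omega
  have h2 : 2 * j.1 / 2 = j.1 := by omega
  have h3 : (2 * j.1 + 1) % 2 = 1 := by omega
  simp only [gaussCentre, holoCoord, antiholoCoord, h1, h2, h3, Nat.mul_mod_right, if_true,
    one_ne_zero, if_false, map_mul, map_add, map_sub, MvPolynomial.aeval_X, MvPolynomial.aeval_C,
    Sum.elim_inl, Sum.elim_inr, Complex.normSq_eq_conj_mul_self, zc, Complex.conj_ofReal,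
    Complex.conj_I, Complex.ofReal_div, Algebra.algebraMap_self,
    RingHom.id_apply, Fin.eta, Complex.ofReal_ofNat]
  ring_nf
  simp only [Complex.I_sq, show Complex.I ^ 3 = -Complex.I by rw [pow_succ, Complex.I_sq]; ring,
    Complex.I_pow_four]
  ring

/-!
Statement 9: Kernel calculus for the Gaussian kernel `𝒫`.

For any positive `a₁,…,a_n` and any polynomials `F, G ∈ ℂ[Z,Z']` there exists a
polynomial `𝒦[F,G] ∈ ℂ[Z,Z']` such that the composition of the kernels `F𝒫` and `G𝒫`
on `ℝ^{2n}` (with respect to the Lebesgue measure) satisfies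
`((F𝒫) ∘ (G𝒫))(Z,Z') = 𝒦[F,G](Z,Z') 𝒫(Z,Z')`.
-/

theorem gaussian_kernel_calculus
    (n : ℕ) (a : Fin n → ℝ) (ha : ∀ j, 0 < a j)
    (F G : MvPolynomial (Fin (2 * n) ⊕ Fin (2 * n)) ℂ) :
    ∃ K : MvPolynomial (Fin (2 * n) ⊕ Fin (2 * n)) ℂ,
      ∀ Z Z' : V n,
        (∫ Z'' : V n,
          (MvPolynomial.eval
              (Sum.elim (fun j => (Z j : ℂ)) (fun j => (Z'' j : ℂ))) F)
            * gaussP a Z Z''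
            * (MvPolynomial.eval
                (Sum.elim (fun j => (Z'' j : ℂ)) (fun j => (Z' j : ℂ))) G)
            * gaussP a Z'' Z')
        = (MvPolynomial.eval
            (Sum.elim (fun j => (Z j : ℂ)) (fun j => (Z' j : ℂ))) K)
            * gaussP a Z Z' := by
  let F' : MvPolynomial (Fin (2 * n)) (MvPolynomial (Fin (2 * n) ⊕ Fin (2 * n)) ℂ) :=
    MvPolynomial.aeval (Sum.elim (fun j => .C (.X (.inl j))) .X) F
  let G' : MvPolynomial (Fin (2 * n)) (MvPolynomial (Fin (2 * n) ⊕ Fin (2 * n)) ℂ) :=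
    MvPolynomial.aeval (Sum.elim .X (fun j => .C (.X (.inr j)))) G
  obtain ⟨K, hK⟩ := exists_integral_eval₂_mul_prod_cexp
    (b := fun i : Fin (2 * n) => a ⟨i.1 / 2, by omega⟩ / 2) (fun i => half_pos (ha _))
    gaussCentre (F' * G')
  refine ⟨K, fun Z Z' => ?_⟩
  set φ : MvPolynomial (Fin (2 * n) ⊕ Fin (2 * n)) ℂ →ₐ[ℂ] ℂ :=
    MvPolynomial.aeval (Sum.elim (fun j => (Z j : ℂ)) (fun j => (Z' j : ℂ))) with hφ
  have heval (s : Fin (2 * n) ⊕ Fin (2 * n) →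
        MvPolynomial (Fin (2 * n)) (MvPolynomial (Fin (2 * n) ⊕ Fin (2 * n)) ℂ))
      (w : Fin (2 * n) → ℂ) (P : MvPolynomial (Fin (2 * n) ⊕ Fin (2 * n)) ℂ) :
      MvPolynomial.eval₂ (φ : _ →+* ℂ) w (MvPolynomial.aeval s P) =
        MvPolynomial.eval (fun i => MvPolynomial.eval₂ (φ : _ →+* ℂ) w (s i)) P := by
    induction P using MvPolynomial.induction_on with
    | C r => simp [MvPolynomial.algebraMap_apply, MvPolynomial.algebraMap_eq, hφ]
    | add p q hp hq => simp [hp, hq, MvPolynomial.eval₂_add]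
    | mul_X p i hp => simp [hp, MvPolynomial.eval₂_mul]
  have hintegrand (W : V n) :
      MvPolynomial.eval (Sum.elim (fun j => (Z j : ℂ)) (fun j => (W j : ℂ))) F * gaussP a Z W *
        MvPolynomial.eval (Sum.elim (fun j => (W j : ℂ)) (fun j => (Z' j : ℂ))) G *
          gaussP a W Z' =
      gaussP a Z Z' * (MvPolynomial.eval₂ (φ : _ →+* ℂ) (fun i => (W i : ℂ)) (F' * G') *
        ∏ i : Fin (2 * n), Complex.exp (-((a ⟨i.1 / 2, by omega⟩ / 2 : ℝ) : ℂ) *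
          ((W i : ℂ) - φ (gaussCentre i)) ^ 2)) := by
    have hF : MvPolynomial.eval₂ (φ : _ →+* ℂ) (fun i => (W i : ℂ)) F' =
        MvPolynomial.eval (Sum.elim (fun j => (Z j : ℂ)) (fun j => (W j : ℂ))) F := by
      rw [heval]
      congr 2 with i
      rcases i with i | i <;> simp [hφ]
    have hG : MvPolynomial.eval₂ (φ : _ →+* ℂ) (fun i => (W i : ℂ)) G' =
        MvPolynomial.eval (Sum.elim (fun j => (W j : ℂ)) (fun j => (Z' j : ℂ))) G := by
      rw [heval]
      congr 2 with i
      rcases i with i | i <;> simp [hφ]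
    rw [MvPolynomial.eval₂_mul, hF, hG]
    linear_combination
      MvPolynomial.eval (Sum.elim (fun j => (Z j : ℂ)) (fun j => (W j : ℂ))) F *
      MvPolynomial.eval (Sum.elim (fun j => (W j : ℂ)) (fun j => (Z' j : ℂ))) G *
        gaussP_mul_gaussP a Z W Z'
  simp only [hintegrand]
  rw [integral_const_mul, mul_comm]
  congr 1
  rw [← MvPolynomial.coe_aeval_eq_eval, RingHom.coe_coe, ← hφ, ← (hK φ).2]
  exact (EuclideanSpace.volume_preserving_symm_measurableEquiv_toLp (Fin (2 * n))).integral_comp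
    (MeasurableEquiv.measurableEmbedding _) fun w : Fin (2 * n) → ℝ =>
      MvPolynomial.eval₂ (φ : _ →+* ℂ) (fun i => (w i : ℂ)) (F' * G') *
        ∏ i : Fin (2 * n), Complex.exp (-((a ⟨i.1 / 2, by omega⟩ / 2 : ℝ) : ℂ) *
          ((w i : ℂ) - φ (gaussCentre i)) ^ 2)
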